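/- Maximum modulus principle for slice regular functions: Let f : Ω → ℍ be a slice regular function on a slice domain Ω. If |f| has a relative maximum point in Ω (i.e. there exist p ∈ Ω and an open neighborhood U ⊆ Ω of p with |f(q)| ≤ |f(p)| for all q ∈ U), then f is constant on Ω. -/

import Mathlib

open scoped Quaternion

/-- The sphere of imaginary units in the quaternions. -/
def qSphere : Set ℍ[ℝ] := {q : ℍ[ℝ] | q.re = 0 ∧ ‖q‖ = 1}

/-- The point of the slice `L_I = ℝ + ℝI` corresponding to `z = x + iy ∈ ℂ`. -/
noncomputable def toSlice (I : ℍ[ℝ]) (z : ℂ) : ℍ[ℝ] := (z.re : ℍ[ℝ]) + z.im • I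

/-- `f` is slice regular on `Ω`: for each imaginary unit `I`, the restriction of `f` to
`Ω ∩ L_I`, read through the parametrization `toSlice I : ℂ → L_I`, is real differentiable
and satisfies the Cauchy–Riemann equation `∂f/∂x + I ∂f/∂y = 0`. -/
def SliceRegularOn (f : ℍ[ℝ] → ℍ[ℝ]) (Ω : Set ℍ[ℝ]) : Prop :=
  ∀ I ∈ qSphere, ∀ z : ℂ, toSlice I z ∈ Ω →
    ∃ D : ℂ →L[ℝ] ℍ[ℝ],
      HasFDerivWithinAt (fun w => f (toSlice I w)) D (toSlice I ⁻¹' Ω) z ∧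
      D 1 + I * D Complex.I = 0

/-- A slice domain: a domain meeting the real axis all of whose slices are domains. -/
def IsSliceDomain (Ω : Set ℍ[ℝ]) : Prop :=
  IsOpen Ω ∧ IsConnected Ω ∧ (∃ x : ℝ, (x : ℍ[ℝ]) ∈ Ω) ∧
  ∀ I ∈ qSphere, IsConnected (toSlice I ⁻¹' Ω)

/-- `cos θ + I sin θ`. -/
noncomputable def expI (I : ℍ[ℝ]) (θ : ℝ) : ℍ[ℝ] := (Real.cos θ : ℍ[ℝ]) + Real.sin θ • I

/-- The circular cone of opening `φ` around the positive real axis. -/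
def circularCone (φ : ℝ) : Set ℍ[ℝ] :=
  {q : ℍ[ℝ] | ∃ r θ : ℝ, ∃ I ∈ qSphere, 0 < r ∧ |θ| < φ / 2 ∧ q = r • expI I θ}

/-- `M_f(r)`: the maximum of `‖f‖` on the closure of `Ω` intersected with the sphere of radius `r`. -/
noncomputable def maxMod (f : ℍ[ℝ] → ℍ[ℝ]) (Ω : Set ℍ[ℝ]) (r : ℝ) : ℝ :=
  sSup ((fun q => ‖f q‖) '' (closure Ω ∩ Metric.sphere (0 : ℍ[ℝ]) r))

/-- The order of a slice regular function. -/
noncomputable def growthOrder (f : ℍ[ℝ] → ℍ[ℝ]) (Ω : Set ℍ[ℝ]) : EReal :=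
  Filter.limsup (fun r : ℝ =>
    ((max 0 (Real.log (max 0 (Real.log (maxMod f Ω r)))) / Real.log r : ℝ) : EReal))
    Filter.atTop

/-- The type of a slice regular function of order `ρ`. -/
noncomputable def growthType (f : ℍ[ℝ] → ℍ[ℝ]) (Ω : Set ℍ[ℝ]) (ρ : ℝ) : EReal :=
  Filter.limsup (fun r : ℝ => ((max 0 (Real.log (maxMod f Ω r)) / r ^ ρ : ℝ) : EReal))
    Filter.atTop

/-- The angle of opening `φ` bisected by the half line of argument `ζ` in the slice `L_I`. -/
def angleSet (I : ℍ[ℝ]) (ζ φ : ℝ) : Set ℍ[ℝ] :=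
  {q : ℍ[ℝ] | ∃ r θ : ℝ, 0 < r ∧ |θ| < φ / 2 ∧ q = r • expI I (ζ + θ)}

/-- The real affine line through `p` with direction `d`. -/
def lineSet (p d : ℍ[ℝ]) : Set ℍ[ℝ] := {q : ℍ[ℝ] | ∃ t : ℝ, q = p + t • d}

/-- `f` is slice preserving: it maps each slice into itself. -/
def SlicePreservingOn (f : ℍ[ℝ] → ℍ[ℝ]) (Ω : Set ℍ[ℝ]) : Prop :=
  ∀ I ∈ qSphere, ∀ q ∈ Ω ∩ Set.range (toSlice I), f q ∈ Set.range (toSlice I)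

/-- The principal quaternionic logarithm. -/
noncomputable def QLog (q : ℍ[ℝ]) : ℍ[ℝ] :=
  (Real.log ‖q‖ : ℍ[ℝ]) + Real.arccos (q.re / ‖q‖) • (‖q.im‖⁻¹ • q.im)


open Filter Topology

theorem mul_self_of_mem_qSphere {I : ℍ[ℝ]} (hI : I ∈ qSphere) : I * I = -1 := by
  have h := Quaternion.self_mul_star I
  rw [Quaternion.normSq_eq_norm_mul_self, hI.2] at h
  rw [Quaternion.star_eq_neg.mpr hI.1] at h
  simpa [neg_eq_iff_eq_neg] using h

theorem continuous_toSlice (I : ℍ[ℝ]) : Continuous (toSlice I) := by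
  unfold toSlice
  exact (Quaternion.continuous_coe.comp Complex.continuous_re).add
    (Complex.continuous_im.smul continuous_const)

@[simp]
theorem toSlice_ofReal (I : ℍ[ℝ]) (x : ℝ) : toSlice I x = x := by
  simp [toSlice]

theorem exists_toSlice_eq (q : ℍ[ℝ]) : ∃ I ∈ qSphere, ∃ z : ℂ, toSlice I z = q := by
  by_cases h : q.im = 0
  · refine ⟨Quaternion.coeComplex Complex.I, ⟨by simp, ?_⟩, q.re, ?_⟩
    · rw [← sq_eq_sq₀ (norm_nonneg _) zero_le_one, sq, ← Quaternion.normSq_eq_norm_mul_self,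
        Quaternion.normSq_def']
      simp
    · rw [toSlice_ofReal]
      conv_rhs => rw [← Quaternion.re_add_im q, h, add_zero]
  · refine ⟨‖q.im‖⁻¹ • q.im, ⟨by simp, ?_⟩, ⟨q.re, ‖q.im‖⟩, ?_⟩
    · rw [norm_smul, norm_inv, norm_norm, inv_mul_cancel₀ (norm_ne_zero_iff.mpr h)]
    · simp [toSlice, smul_smul, h]

/-- The real-linear map `q ↦ ⟪a, q⟫ - i ⟪a, I q⟫`, which intertwines left multiplication by the
imaginary unit `I` with multiplication by `i`. -/
noncomputable def sliceFunctional (I a : ℍ[ℝ]) : ℍ[ℝ] →L[ℝ] ℂ :=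
  Complex.ofRealCLM.comp (innerSL ℝ a) -
    Complex.I • Complex.ofRealCLM.comp ((innerSL ℝ a).comp (ContinuousLinearMap.mul ℝ ℍ[ℝ] I))

theorem sliceFunctional_apply (I a q : ℍ[ℝ]) :
    sliceFunctional I a q = (inner ℝ a q : ℝ) - Complex.I * (inner ℝ a (I * q) : ℝ) := by
  simp [sliceFunctional]

@[simp]
theorem sliceFunctional_re (I a q : ℍ[ℝ]) : (sliceFunctional I a q).re = inner ℝ a q := by
  simp [sliceFunctional_apply]

theorem sliceFunctional_mul {I : ℍ[ℝ]} (hI : I ∈ qSphere) (a q : ℍ[ℝ]) :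
    sliceFunctional I a (I * q) = Complex.I * sliceFunctional I a q := by
  rw [sliceFunctional_apply, sliceFunctional_apply, ← mul_assoc, mul_self_of_mem_qSphere hI,
    neg_one_mul, inner_neg_right]
  apply Complex.ext <;> simp

theorem SliceRegularOn.differentiableOn_sliceFunctional {f : ℍ[ℝ] → ℍ[ℝ]} {Ω : Set ℍ[ℝ]}
    (hf : SliceRegularOn f Ω) (hΩ : IsOpen Ω) {I : ℍ[ℝ]} (hI : I ∈ qSphere) (a : ℍ[ℝ]) :
    DifferentiableOn ℂ (fun z => sliceFunctional I a (f (toSlice I z))) (toSlice I ⁻¹' Ω) := by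
  intro z hz
  obtain ⟨D, hD, hCR⟩ := hf I hI z hz
  have hD' := (sliceFunctional I a).hasFDerivAt.comp z
    (hD.hasFDerivAt ((hΩ.preimage (continuous_toSlice I)).mem_nhds hz))
  have hDI : D Complex.I = I * D 1 := by
    rw [eq_neg_of_add_eq_zero_left hCR, mul_neg, ← mul_assoc, mul_self_of_mem_qSphere hI]
    simp
  refine (differentiableAt_complex_iff_differentiableAt_real.mpr
    ⟨hD'.differentiableAt, ?_⟩).differentiableWithinAt
  rw [hD'.fderiv]
  simp [hDI, sliceFunctional_mul hI]

theorem SliceRegularOn.eqOn_slice_of_frequently_eq {f : ℍ[ℝ] → ℍ[ℝ]} {Ω : Set ℍ[ℝ]}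
    (hf : SliceRegularOn f Ω) (hΩ : IsOpen Ω) {I : ℍ[ℝ]} (hI : I ∈ qSphere)
    (hconn : IsPreconnected (toSlice I ⁻¹' Ω)) {z₀ : ℂ} (hz₀ : toSlice I z₀ ∈ Ω) {c : ℍ[ℝ]}
    (h : ∃ᶠ z in 𝓝[≠] z₀, f (toSlice I z) = c) :
    ∀ z, toSlice I z ∈ Ω → f (toSlice I z) = c := by
  intro z hz
  refine ext_inner_left ℝ fun a => ?_
  have ha := ((hf.differentiableOn_sliceFunctional hΩ hI a).analyticOnNhd
    (hΩ.preimage (continuous_toSlice I))).eqOn_of_preconnected_of_frequently_eq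
      (analyticOnNhd_const (v := sliceFunctional I a c)) hconn hz₀
      (h.mono fun w hw => by rw [hw]) hz
  simpa using congrArg Complex.re ha

theorem SliceRegularOn.eventually_eq_of_isLocalMax_norm {f : ℍ[ℝ] → ℍ[ℝ]} {Ω : Set ℍ[ℝ]}
    (hf : SliceRegularOn f Ω) (hΩ : IsOpen Ω) {I : ℍ[ℝ]} (hI : I ∈ qSphere) {z₀ : ℂ}
    (hz₀ : toSlice I z₀ ∈ Ω) (h : IsLocalMax (fun z => ‖f (toSlice I z)‖) z₀) :
    ∀ᶠ z in 𝓝 z₀, f (toSlice I z) = f (toSlice I z₀) := by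
  set a := f (toSlice I z₀)
  have hopen := (hΩ.preimage (continuous_toSlice I)).mem_nhds hz₀
  have hdiff : ∀ᶠ z in 𝓝 z₀, DifferentiableAt ℂ
      (fun z => Complex.exp (sliceFunctional I a (f (toSlice I z)))) z :=
    (hf.differentiableOn_sliceFunctional hΩ hI a).cexp.eventually_differentiableAt hopen
  have hmax : IsLocalMax
      (norm ∘ fun z => Complex.exp (sliceFunctional I a (f (toSlice I z)))) z₀ := by
    filter_upwards [h] with z hz
    simp only [Function.comp_apply, Complex.norm_exp, sliceFunctional_re, Real.exp_le_exp]
    calc inner ℝ a (f (toSlice I z)) ≤ ‖a‖ * ‖f (toSlice I z)‖ := real_inner_le_norm _ _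
      _ ≤ ‖a‖ * ‖a‖ := mul_le_mul_of_nonneg_left hz (norm_nonneg _)
      _ = inner ℝ a a := (real_inner_self_eq_norm_mul_norm a).symm
  filter_upwards [h, Complex.eventually_eq_of_isLocalMax_norm hdiff hmax] with z hz hexp
  have hinner : inner ℝ a (f (toSlice I z)) = ‖a‖ ^ 2 := by
    simpa [Complex.norm_exp, a] using congrArg norm hexp
  have hnorm : ‖f (toSlice I z) - a‖ ^ 2 ≤ 0 := by
    rw [norm_sub_sq_real, real_inner_comm, hinner]
    have := pow_le_pow_left₀ (norm_nonneg _) hz 2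
    linarith
  exact sub_eq_zero.mp (norm_eq_zero.mp (pow_eq_zero_iff two_ne_zero |>.mp
    (le_antisymm hnorm (sq_nonneg _))))

/-- Maximum modulus principle for slice regular functions. -/
theorem maximum_modulus
    (Ω : Set ℍ[ℝ]) (hΩ : IsSliceDomain Ω)
    (f : ℍ[ℝ] → ℍ[ℝ]) (hf : SliceRegularOn f Ω)
    (p : ℍ[ℝ]) (hp : p ∈ Ω)
    (U : Set ℍ[ℝ]) (hU : IsOpen U) (hpU : p ∈ U) (hUΩ : U ⊆ Ω)
    (hmax : ∀ q ∈ U, ‖f q‖ ≤ ‖f p‖) :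
    ∀ q ∈ Ω, f q = f p := by
  obtain ⟨hopen, -, ⟨x₀, hx₀⟩, hconn⟩ := hΩ
  obtain ⟨I, hI, z₀, rfl⟩ := exists_toSlice_eq p
  have hloc : IsLocalMax (fun z => ‖f (toSlice I z)‖) z₀ :=
    ((hU.preimage (continuous_toSlice I)).eventually_mem hpU).mono fun z hz => hmax _ hz
  have hfI := hf.eqOn_slice_of_frequently_eq hopen hI (hconn I hI).isPreconnected hp
    ((hf.eventually_eq_of_isLocalMax_norm hopen hI hp hloc).filter_mono
      nhdsWithin_le_nhds).frequently
  intro q hq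
  obtain ⟨J, hJ, w, rfl⟩ := exists_toSlice_eq q
  refine hf.eqOn_slice_of_frequently_eq hopen hJ (hconn J hJ).isPreconnected (z₀ := x₀)
    (by simpa using hx₀) ?_ w hq
  have hreal : ∀ᶠ x : ℝ in 𝓝[≠] x₀, f (toSlice J x) = f (toSlice I z₀) := by
    filter_upwards [nhdsWithin_le_nhds
      ((hopen.preimage Quaternion.continuous_coe).mem_nhds hx₀)] with x hx
    have := hfI x (by simpa using hx)
    simpa using this
  exact (Complex.continuous_ofReal.continuousAt.continuousWithinAt.tendsto_nhdsWithin
    fun x hx => by simpa using hx).frequently hreal.frequently
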